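/- Let G be a countable amenable group and let A be any subgroup of G. Then the double of G over A, i.e., the amalgamated free product G ∗_A G of two copies of G amalgamated along the two copies of A via the identity isomorphism, belongs to the class 𝒜. -/

import Mathlib

/-- A `G`-invariant mean on `X`, for the `G`-action on `X` given by `φ`:
a finitely additive probability "measure" on the subsets of `X` invariant under `G`. -/
def IsInvariantMean {G X : Type*} [Group G] (φ : G →* Equiv.Perm X)
    (μ : Set X → ℝ) : Prop :=
  (∀ S : Set X, 0 ≤ μ S) ∧ μ Set.univ = 1 ∧
  (∀ S T : Set X, Disjoint S T → μ (S ∪ T) = μ S + μ T) ∧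
  (∀ (g : G) (S : Set X), μ ((φ g) '' S) = μ S)

/-- The action of `G` on `X` given by `φ` is amenable: there is a `G`-invariant mean on `X`. -/
def AmenableAction {G X : Type*} [Group G] (φ : G →* Equiv.Perm X) : Prop :=
  ∃ μ : Set X → ℝ, IsInvariantMean φ μ

/-- A group is amenable if its left-translation action on itself is amenable. -/
def AmenableGroup (G : Type*) [Group G] : Prop :=
  AmenableAction (MulAction.toPermHom G G)

/-- A group `G` is in the class `𝒜` if it admits a transitive, faithful and
amenable action on some countable set. -/
def InClassA (G : Type*) [Group G] : Prop :=
  ∃ (X : Type) (_ : Countable X) (φ : G →* Equiv.Perm X),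
    Function.Injective φ ∧ (∀ x y : X, ∃ g : G, φ g x = y) ∧ AmenableAction φ

/-- `(P, jG, jH)` is the amalgamated free product of `G` and `H` over `A`
(along the homomorphisms `iG : A →* G` and `iH : A →* H`), i.e. it is a pushout
of `iG` and `iH` in the category of groups. -/
def IsAmalgamatedProduct {A G H P : Type*} [Group A] [Group G] [Group H] [Group P]
    (iG : A →* G) (iH : A →* H) (jG : G →* P) (jH : H →* P) : Prop :=
  jG.comp iG = jH.comp iH ∧
  ∀ (L : Type) [Group L] (fG : G →* L) (fH : H →* L),
    fG.comp iG = fH.comp iH → ∃! f : P →* L, f.comp jG = fG ∧ f.comp jH = fH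

open Filter Topology

/-- A finitely additive probability measure defined on all subsets of `X`. -/
structure IsMean {X : Type*} (μ : Set X → ℝ) : Prop where
  nonneg (S : Set X) : 0 ≤ μ S
  univ : μ Set.univ = 1
  union (S T : Set X) : Disjoint S T → μ (S ∪ T) = μ S + μ T

namespace IsMean

variable {X Y : Type*} {μ : Set X → ℝ}

lemma inter_add_diff (hμ : IsMean μ) (S D : Set X) : μ (S ∩ D) + μ (S \ D) = μ S := by
  rw [← hμ.union _ _ Set.disjoint_sdiff_inter.symm, Set.inter_union_sdiff]

lemma mono (hμ : IsMean μ) {S T : Set X} (h : S ⊆ T) : μ S ≤ μ T := by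
  have h1 := hμ.inter_add_diff T S
  rw [Set.inter_eq_self_of_subset_right h] at h1
  linarith [hμ.nonneg (T \ S)]

lemma le_one (hμ : IsMean μ) (S : Set X) : μ S ≤ 1 :=
  hμ.univ ▸ hμ.mono (Set.subset_univ S)

lemma inter_eq_of_eq_one (hμ : IsMean μ) (S : Set X) {D : Set X} (hD : μ D = 1) :
    μ (S ∩ D) = μ S := by
  have h1 := hμ.inter_add_diff S D
  have h2 := hμ.inter_add_diff Set.univ D
  rw [Set.univ_inter, hμ.univ, hD] at h2
  have h3 : μ (S \ D) ≤ μ (Set.univ \ D) := hμ.mono (Set.sdiff_subset_sdiff_left (Set.subset_univ S))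
  linarith [hμ.nonneg (S \ D)]

/-- Sets which agree on a set of full measure have the same measure. -/
lemma congr_of_eq_one (hμ : IsMean μ) {S T D : Set X} (hD : μ D = 1)
    (h : ∀ x ∈ D, x ∈ S ↔ x ∈ T) : μ S = μ T := by
  rw [← hμ.inter_eq_of_eq_one S hD, ← hμ.inter_eq_of_eq_one T hD]
  congr 1
  ext x
  exact and_congr_left (h x)

lemma map (hμ : IsMean μ) (f : X → Y) : IsMean fun S => μ (f ⁻¹' S) where
  nonneg _ := hμ.nonneg _
  univ := hμ.univ
  union _ _ h := hμ.union _ _ (h.preimage f)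

end IsMean

lemma IsInvariantMean.isMean {G X : Type*} [Group G] {φ : G →* Equiv.Perm X} {μ : Set X → ℝ}
    (h : IsInvariantMean φ μ) : IsMean μ :=
  ⟨h.1, h.2.1, h.2.2.1⟩

lemma IsInvariantMean.preimage {G X : Type*} [Group G] {φ : G →* Equiv.Perm X} {μ : Set X → ℝ}
    (h : IsInvariantMean φ μ) (g : G) (S : Set X) : μ (φ g ⁻¹' S) = μ S := by
  rw [← Equiv.image_symm_eq_preimage, ← Equiv.Perm.inv_def, ← map_inv]
  exact h.2.2.2 _ _

/-- To check invariance of a mean it is enough to consider a generating set. -/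
lemma IsMean.amenableAction {P X : Type*} [Group P] {φ : P →* Equiv.Perm X} {μ : Set X → ℝ}
    (hμ : IsMean μ) {s : Set P} (hs : Subgroup.closure s = ⊤)
    (h : ∀ p ∈ s, ∀ S, μ (φ p ⁻¹' S) = μ S) : AmenableAction φ := by
  have key (p : P) : ∀ S, μ (φ p ⁻¹' S) = μ S := by
    have hp : p ∈ Subgroup.closure s := hs ▸ Subgroup.mem_top p
    induction hp using Subgroup.closure_induction with
    | mem p hp => exact h p hp
    | one => simp
    | mul p q _ _ ihp ihq =>
      intro S
      rw [map_mul, Equiv.Perm.coe_mul, Set.preimage_comp, ihq, ihp]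
    | inv p _ ih =>
      intro S
      rw [← ih (φ p⁻¹ ⁻¹' S), ← Set.preimage_comp, ← Equiv.Perm.coe_mul, ← map_mul]
      simp
  refine ⟨μ, hμ.nonneg, hμ.univ, hμ.union, fun p S => ?_⟩
  rw [Equiv.image_eq_preimage_symm, ← Equiv.Perm.inv_def, ← map_inv, key]

/-- A mean on `G` can be combined with a Banach limit on `ℤ` which is concentrated on the
nonnegative integers. -/
lemma exists_isMean_int_prod {G : Type*} [Group G] {m : Set G → ℝ}
    (hm : IsInvariantMean (MulAction.toPermHom G G) m) :
    ∃ M : Set (ℤ × G) → ℝ, IsMean M ∧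
      (∀ S, M ((fun x => (x.1 + 1, x.2)) ⁻¹' S) = M S) ∧
      (∀ g S, M ((fun x => (x.1, g * x.2)) ⁻¹' S) = M S) ∧
      M {x | 0 ≤ x.1} = 1 := by
  set f : Set (ℤ × G) → ℕ → ℝ := fun S k => m {g | ((k : ℤ), g) ∈ S} with hf
  set a : Set (ℤ × G) → ℕ → ℝ := fun S N => (∑ k ∈ Finset.range (N + 1), f S k) / (N + 1) with ha
  have hf0 (S k) : 0 ≤ f S k := hm.isMean.nonneg _
  have hf1 (S k) : f S k ≤ 1 := hm.isMean.le_one _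
  have ha0 (S N) : 0 ≤ a S N := div_nonneg (Finset.sum_nonneg fun k _ => hf0 S k) (by positivity)
  have ha1 (S N) : a S N ≤ 1 := by
    refine div_le_one_of_le₀ ?_ (by positivity)
    simpa using Finset.sum_le_card_nsmul (Finset.range (N + 1)) (f S) 1 fun k _ => hf1 S k
  have hlim (S) : ∃ l, Tendsto (a S) (hyperfilter ℕ) (𝓝 l) := by
    obtain ⟨l, -, hl⟩ := (isCompact_Icc (a := (0 : ℝ)) (b := 1)).ultrafilter_le_nhds
      ((hyperfilter ℕ).map (a S))
      (le_principal_iff.2 (Ultrafilter.mem_map.2 (univ_mem' fun N => ⟨ha0 S N, ha1 S N⟩)))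
    exact ⟨l, hl⟩
  choose M hM using hlim
  have hone {S} (h : ∀ k, f S k = 1) : M S = 1 := by
    refine tendsto_nhds_unique (hM S) (tendsto_const_nhds.congr fun N => ?_)
    simp only [ha, h]
    simp [div_self (Nat.cast_add_one_ne_zero (R := ℝ) N)]
  refine ⟨M, ⟨fun S => ge_of_tendsto' (hM S) (ha0 S), hone fun k => ?_, fun S T hST => ?_⟩,
    fun S => ?_, fun g S => ?_, hone fun k => ?_⟩
  · simpa [hf] using hm.isMean.univ
  · refine tendsto_nhds_unique (hM _) (((hM S).add (hM T)).congr fun N => ?_)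
    simp only [ha]
    rw [← add_div, ← Finset.sum_add_distrib]
    congr 1
    refine Finset.sum_congr rfl fun k _ => (hm.isMean.union _ _ ?_).symm
    exact hST.preimage fun g : G => ((k : ℤ), g)
  · have h0 : Tendsto (fun N : ℕ => (f S (N + 1) - f S 0) / ((N : ℝ) + 1)) (hyperfilter ℕ) (𝓝 0) := by
      have h1 : Tendsto (fun N : ℕ => 1 / ((N : ℝ) + 1)) (hyperfilter ℕ) (𝓝 0) :=
        tendsto_one_div_add_atTop_nhds_zero_nat.mono_left Nat.hyperfilter_le_atTop
      refine squeeze_zero_norm (fun N => ?_) h1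
      rw [norm_div, Real.norm_of_nonneg (by positivity : (0 : ℝ) ≤ N + 1)]
      gcongr
      rw [Real.norm_eq_abs, abs_le]
      constructor <;> linarith [hf0 S (N + 1), hf1 S (N + 1), hf0 S 0, hf1 S 0]
    have h2 := h0.add (hM S)
    rw [zero_add] at h2
    refine tendsto_nhds_unique (hM _) (h2.congr fun N => ?_)
    have h3 (k : ℕ) : f ((fun x => (x.1 + 1, x.2)) ⁻¹' S) k = f S (k + 1) := by
      simp [hf]
    simp only [ha, h3]
    rw [← add_div]
    congr 1
    have h4 := Finset.sum_range_sub (f S) (N + 1)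
    rw [Finset.sum_sub_distrib] at h4
    linarith
  · refine tendsto_nhds_unique (hM _) ((hM S).congr fun N => ?_)
    simp only [ha]
    congr 1
    exact Finset.sum_congr rfl fun k _ => (hm.preimage g _).symm
  · simpa [hf] using hm.isMean.univ

lemma IsMean.int_prod_shift {G : Type*} {M : Set (ℤ × G) → ℝ}
    (h : ∀ S, M ((fun x => (x.1 + 1, x.2)) ⁻¹' S) = M S) (n : ℤ) (S : Set (ℤ × G)) :
    M ((fun x => (x.1 + n, x.2)) ⁻¹' S) = M S := by
  induction n using Int.induction_on generalizing S with
  | zero => simp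
  | succ n ih =>
    rw [← h S, ← ih ((fun x => (x.1 + 1, x.2)) ⁻¹' S)]
    simp only [Set.preimage, Set.mem_ofPred_eq, add_assoc]
  | pred n ih =>
    rw [← ih S, ← h ((fun x => (x.1 + (-(n : ℤ) - 1), x.2)) ⁻¹' S)]
    simp only [Set.preimage, Set.mem_ofPred_eq]
    congr! 5
    ring

open Classical in
/-- A shift-invariant mean on `ℤ × G` is also invariant under shifting over a subset of `G`. -/
lemma IsMean.int_prod_shift_on {G : Type*} {M : Set (ℤ × G) → ℝ} (hM : IsMean M)
    (h : ∀ S, M ((fun x => (x.1 + 1, x.2)) ⁻¹' S) = M S) (n : ℤ) (E : Set G) (S : Set (ℤ × G)) :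
    M ((fun x => (x.1 + if x.2 ∈ E then n else 0, x.2)) ⁻¹' S) = M S := by
  set T := (fun x : ℤ × G => (x.1 + if x.2 ∈ E then n else 0, x.2)) ⁻¹' S with hT
  have h1 : T ∩ {x | x.2 ∈ E} = (fun x => (x.1 + n, x.2)) ⁻¹' (S ∩ {x | x.2 ∈ E}) := by
    ext x
    by_cases hx : x.2 ∈ E <;> simp [hT, hx]
  have h2 : T \ {x | x.2 ∈ E} = S \ {x | x.2 ∈ E} := by
    ext x
    by_cases hx : x.2 ∈ E <;> simp [hT, hx]
  rw [← hM.inter_add_diff T {x | x.2 ∈ E}, h1, h2, int_prod_shift h, hM.inter_add_diff]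

/-- Permutations of a set of free generators extend to automorphisms of the free group. -/
def FreeGroup.permAut (Z : Type*) : Equiv.Perm Z →* MulAut (FreeGroup Z) where
  toFun e := FreeGroup.freeGroupCongr e
  map_one' := FreeGroup.freeGroupCongr_refl
  map_mul' e f := (FreeGroup.freeGroupCongr_trans f e).symm

@[simp]
lemma FreeGroup.permAut_of {Z : Type*} (e : Equiv.Perm Z) (z : Z) :
    FreeGroup.permAut Z e (FreeGroup.of z) = FreeGroup.of (e z) := by
  simp [FreeGroup.permAut]

open Classical in
lemma FreeGroup.eq_one_of_forall_mem_closure {Z : Type*} (ρ : Z → ℤ) (v : FreeGroup Z)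
    (hv : ∀ n : ℕ, v ∈ Subgroup.closure (FreeGroup.of '' {z | ρ z ≤ -n})) : v = 1 := by
  let κ (n : ℕ) : FreeGroup Z →* FreeGroup Z :=
    FreeGroup.lift fun z => if ρ z ≤ -n then 1 else FreeGroup.of z
  have h1 (n : ℕ) : κ n v = 1 := by
    have : Subgroup.closure (FreeGroup.of '' {z | ρ z ≤ -n}) ≤ (κ n).ker := by
      rw [Subgroup.closure_le]
      rintro _ ⟨z, hz, rfl⟩
      have hz' : ρ z ≤ -n := hz
      simp [κ, MonoidHom.mem_ker, hz']
    exact this (hv n)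
  have h2 (w : FreeGroup Z) : ∃ N : ℕ, ∀ n ≥ N, κ n w = w := by
    induction w using FreeGroup.induction_on with
    | C1 => exact ⟨0, fun n _ => _root_.map_one _⟩
    | of z =>
      refine ⟨(ρ z).natAbs + 1, fun n hn => ?_⟩
      have : ¬ ρ z ≤ -n := by omega
      simp [κ, this]
    | inv_of z ih =>
      obtain ⟨N, hN⟩ := ih
      exact ⟨N, fun n hn => by rw [_root_.map_inv, hN n hn]⟩
    | mul x y ihx ihy =>
      obtain ⟨N, hN⟩ := ihx
      obtain ⟨N', hN'⟩ := ihy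
      refine ⟨max N N', fun n hn => ?_⟩
      rw [_root_.map_mul, hN n (le_of_max_le_left hn), hN' n (le_of_max_le_right hn)]
  obtain ⟨N, hN⟩ := h2 v
  rw [← hN N le_rfl, h1]

lemma QuotientGroup.mk_eq_mk_one_iff {G : Type*} [Group G] {A : Subgroup G} {g : G} :
    (g : G ⧸ A) = (1 : G) ↔ g ∈ A := by
  rw [eq_comm, QuotientGroup.eq, inv_one, one_mul]

namespace IsAmalgamatedProduct

lemma closure_range_union {A G H P : Type} [Group A] [Group G] [Group H] [Group P]
    {iG : A →* G} {iH : A →* H} {jG : G →* P} {jH : H →* P}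
    (hP : IsAmalgamatedProduct iG iH jG jH) :
    Subgroup.closure (Set.range jG ∪ Set.range jH) = ⊤ := by
  set K := Subgroup.closure (Set.range jG ∪ Set.range jH)
  let fG : G →* K := jG.codRestrict K fun g => Subgroup.subset_closure (.inl ⟨g, rfl⟩)
  let fH : H →* K := jH.codRestrict K fun g => Subgroup.subset_closure (.inr ⟨g, rfl⟩)
  obtain ⟨f, ⟨hfG, hfH⟩, -⟩ := hP.2 K fG fH
    (MonoidHom.ext fun a => Subtype.ext (DFunLike.congr_fun hP.1 a))
  have h : K.subtype.comp f = MonoidHom.id P := by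
    refine (hP.2 P jG jH hP.1).unique ⟨?_, ?_⟩ ⟨rfl, rfl⟩
    · rw [MonoidHom.comp_assoc, hfG]; rfl
    · rw [MonoidHom.comp_assoc, hfH]; rfl
  refine (Subgroup.eq_top_iff' K).2 fun p => ?_
  have hp : (f p : P) = p := DFunLike.congr_fun h p
  exact hp ▸ (f p).2

lemma countable {A G H P : Type} [Group A] [Group G] [Group H] [Group P]
    {iG : A →* G} {iH : A →* H} {jG : G →* P} {jH : H →* P}
    (hP : IsAmalgamatedProduct iG iH jG jH) [Countable G] [Countable H] : Countable P := by
  have h : Function.Surjective ((Monoid.Coprod.lift jG jH).comp Monoid.Coprod.mk) := by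
    refine Function.Surjective.comp (g := Monoid.Coprod.lift jG jH) ?_ Monoid.Coprod.mk_surjective
    rw [← MonoidHom.range_eq_top, Monoid.Coprod.range_lift, ← hP.closure_range_union,
      Subgroup.closure_union, ← MonoidHom.coe_range, ← MonoidHom.coe_range,
      Subgroup.closure_eq, Subgroup.closure_eq]
  have : Countable (FreeMonoid (G ⊕ H)) := inferInstanceAs (Countable (List (G ⊕ H)))
  exact h.countable

variable {G : Type} [Group G] {A : Subgroup G} {P : Type} [Group P] {j₁ j₂ : G →* P}

/-- The elements `j₁ g * (j₂ g)⁻¹` generate the kernel of the folding map of a double. -/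
def diff (j₁ j₂ : G →* P) (g : G) : P := j₁ g * (j₂ g)⁻¹

lemma apply_eq (hP : IsAmalgamatedProduct A.subtype A.subtype j₁ j₂) {a : G} (ha : a ∈ A) :
    j₁ a = j₂ a :=
  DFunLike.congr_fun hP.1 ⟨a, ha⟩

lemma diff_eq (hP : IsAmalgamatedProduct A.subtype A.subtype j₁ j₂) {g h : G}
    (hgh : (g : G ⧸ A) = h) : diff j₁ j₂ g = diff j₁ j₂ h := by
  have h1 := hP.apply_eq (QuotientGroup.eq.1 hgh)
  obtain ⟨a, rfl⟩ : ∃ a, h = g * a := ⟨g⁻¹ * h, by group⟩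
  rw [inv_mul_cancel_left] at h1
  simp [diff, h1]

variable (A) in
/-- The nontrivial cosets of `A`, with the coset of `c` removed. -/
abbrev RemainingCoset (c : G) : Type := {d : G ⧸ A // d ≠ (1 : G) ∧ d ≠ c}

variable (A j₁ j₂) in
/-- The homomorphism sending the generator `(k, gA)` to the conjugate of `diff j₁ j₂ g` by the
`k`-th power of `diff j₁ j₂ c`. -/
noncomputable def liftConj (c : G) : FreeGroup (ℤ × RemainingCoset A c) →* P :=
  FreeGroup.lift fun z =>
    diff j₁ j₂ c ^ z.1 * diff j₁ j₂ (Quotient.out z.2.1) * (diff j₁ j₂ c ^ z.1)⁻¹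

open SemidirectProduct in
open Classical in
lemma liftConj_injective (hP : IsAmalgamatedProduct A.subtype A.subtype j₁ j₂) {c : G}
    (hc : c ∉ A) : Function.Injective (liftConj A j₁ j₂ c) := by
  let α : G →* MulAut (FreeGroup (G ⧸ A)) :=
    (FreeGroup.permAut (G ⧸ A)).comp (MulAction.toPermHom G (G ⧸ A))
  let y (d : G ⧸ A) : FreeGroup (G ⧸ A) := FreeGroup.of d
  have hα (g : G) (d : G ⧸ A) : α g (y d) = y (g • d) := FreeGroup.permAut_of _ _
  obtain ⟨Φ, ⟨hΦ₁, hΦ₂⟩, -⟩ := hP.2 (FreeGroup (G ⧸ A) ⋊[α] G) inr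
    ((MulAut.conj (inl (y (1 : G)))).toMonoidHom.comp inr) (by
      ext1 a
      have ha : ((a : G) : G ⧸ A) = (1 : G) := QuotientGroup.mk_eq_mk_one_iff.2 a.2
      have h := hα a (1 : G)
      rw [MulAction.Quotient.smul_coe, smul_eq_mul, mul_one, ha] at h
      have h2 := inl_aut (φ := α) (a : G) (y (1 : G))
      rw [h] at h2
      simp only [MonoidHom.comp_apply, Subgroup.subtype_apply, MulEquiv.coe_toMonoidHom,
        MulAut.conj_apply]
      nth_rewrite 1 [h2]
      simp)
  have hΦ (g : G) : Φ (diff j₁ j₂ g) = inl (y g * (y (1 : G))⁻¹) := by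
    have h1 : Φ (j₁ g) = inr g := DFunLike.congr_fun hΦ₁ g
    have h2 : Φ (j₂ g) = inl (y (1 : G)) * inr g * (inl (y (1 : G)))⁻¹ := DFunLike.congr_fun hΦ₂ g
    have h3 := inl_aut (φ := α) g (y (1 : G))
    rw [hα, MulAction.Quotient.smul_coe, smul_eq_mul, mul_one] at h3
    rw [diff, map_mul, map_inv, h1, h2, map_mul, map_inv, h3, map_inv]
    group
  obtain ⟨σ, hσ₁⟩ : ∃ σ : Equiv.Perm (ℤ × RemainingCoset A c), ∀ l d, σ (l, d) = (l + 1, d) :=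
    ⟨(Equiv.addRight 1).prodCongr (Equiv.refl _), fun _ _ => rfl⟩
  let β : Multiplicative ℤ →* MulAut (FreeGroup (ℤ × RemainingCoset A c)) :=
    (FreeGroup.permAut _).comp (zpowersHom _ σ)
  have hσ (k l : ℤ) (d) : (σ ^ k) (l, d) = (l + k, d) := by
    induction k using Int.induction_on generalizing l with
    | zero => simp
    | succ k ih => rw [zpow_add_one, Equiv.Perm.mul_apply]; simp only [hσ₁, ih]; congr 1; ring
    | pred k ih =>
      have h : σ⁻¹ (l, d) = (l - 1, d) := by rw [Equiv.Perm.inv_eq_iff_eq, hσ₁, sub_add_cancel]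
      rw [zpow_sub_one, Equiv.Perm.mul_apply, h, ih]
      congr 1
      ring
  let τ : FreeGroup (ℤ × RemainingCoset A c) ⋊[β] Multiplicative ℤ := inr (.ofAdd 1)
  have hτ (k : ℤ) (d) : τ ^ k * inl (FreeGroup.of (0, d)) * (τ ^ k)⁻¹ =
      inl (FreeGroup.of (k, d)) := by
    have h1 := inl_aut (φ := β) (.ofAdd k) (FreeGroup.of (0, d))
    have h2 : τ ^ k = inr (.ofAdd k) := by
      rw [← map_zpow, ← ofAdd_zsmul, smul_eq_mul, mul_one]
    have h3 : β (.ofAdd k) (FreeGroup.of (0, d)) = FreeGroup.of (k, d) := by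
      rw [MonoidHom.comp_apply, zpowersHom_apply, toAdd_ofAdd, FreeGroup.permAut_of, hσ, zero_add]
    rw [h2, ← map_inv, ← h1, h3]
  let θ : FreeGroup (G ⧸ A) →* FreeGroup (ℤ × RemainingCoset A c) ⋊[β] Multiplicative ℤ :=
    FreeGroup.lift fun d =>
      if h : d ≠ (1 : G) ∧ d ≠ c then inl (FreeGroup.of (0, ⟨d, h⟩))
      else if d = c then τ else 1
  have hc1 : (c : G ⧸ A) ≠ (1 : G) := fun h => hc (QuotientGroup.mk_eq_mk_one_iff.1 h)
  have hθ1 : θ (y (1 : G)) = 1 := by simp [θ, y, hc1.symm]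
  have hθc : θ (y c) = τ := by simp [θ, y]
  have hθ (d : RemainingCoset A c) : θ (y d.1) = inl (FreeGroup.of (0, d)) := by
    simp [θ, y, d.2]
  let s : FreeGroup (G ⧸ A) := y c * (y (1 : G))⁻¹
  let l : FreeGroup (ℤ × RemainingCoset A c) →* FreeGroup (G ⧸ A) :=
    FreeGroup.lift fun z => s ^ z.1 * (y z.2.1 * (y (1 : G))⁻¹) * (s ^ z.1)⁻¹
  have hl : Φ.comp (liftConj A j₁ j₂ c) = inl.comp l := by
    ext1 z
    have h1 : Φ (diff j₁ j₂ (Quotient.out z.2.1)) = inl (y z.2.1 * (y (1 : G))⁻¹) := by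
      rw [hΦ, QuotientGroup.out_eq']
    simp only [MonoidHom.comp_apply, liftConj, l, FreeGroup.lift_apply_of, map_mul Φ, map_zpow,
      map_inv Φ, hΦ c, h1, map_mul inl, map_inv inl, s]
  have hθl : θ.comp l = inl := by
    ext1 z
    simp only [MonoidHom.comp_apply, l, FreeGroup.lift_apply_of, map_mul θ, map_zpow,
      map_inv θ, hθ1, hθc, hθ, s, inv_one, mul_one, hτ]
  intro v w hvw
  have h1 : Φ (liftConj A j₁ j₂ c v) = Φ (liftConj A j₁ j₂ c w) := congrArg Φ hvw
  have h2 : l v = l w := inl_injective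
    ((DFunLike.congr_fun hl v).symm.trans (h1.trans (DFunLike.congr_fun hl w)))
  exact inl_injective ((DFunLike.congr_fun hθl v).symm.trans
    ((congrArg θ h2).trans (DFunLike.congr_fun hθl w)))

variable (A j₁ j₂) in
/-- A core-free subgroup of the double whose coset space carries an invariant mean. -/
noncomputable def stabilizer (c : G) : Subgroup P :=
  (Subgroup.closure (FreeGroup.of '' {z | z.1 ≤ 0})).map (liftConj A j₁ j₂ c)

lemma conj_diff_mem_stabilizer (hP : IsAmalgamatedProduct A.subtype A.subtype j₁ j₂) {c u : G}
    (hu : (u : G ⧸ A) ≠ c) {k : ℤ} (hk : 0 ≤ k) :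
    (diff j₁ j₂ c ^ k)⁻¹ * (diff j₁ j₂ u * diff j₁ j₂ c ^ k) ∈ stabilizer A j₁ j₂ c := by
  by_cases h : (u : G ⧸ A) = (1 : G)
  · have : diff j₁ j₂ u = 1 := by rw [hP.diff_eq h]; simp [diff]
    simp [this, one_mem]
  · refine ⟨FreeGroup.of (-k, ⟨u, h, hu⟩), Subgroup.subset_closure ⟨_, by simpa using hk, rfl⟩, ?_⟩
    have : diff j₁ j₂ (Quotient.out (u : G ⧸ A)) = diff j₁ j₂ u :=
      hP.diff_eq (QuotientGroup.out_eq' _)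
    simp [liftConj, this, mul_assoc]

lemma stabilizer_core (hP : IsAmalgamatedProduct A.subtype A.subtype j₁ j₂) {c : G} (hc : c ∉ A)
    {p : P} (hp : ∀ q : P, q⁻¹ * p * q ∈ stabilizer A j₁ j₂ c) : p = 1 := by
  have key (n : ℕ) : ∃ v ∈ Subgroup.closure (FreeGroup.of '' {z | z.1 ≤ -(n : ℤ)}),
      liftConj A j₁ j₂ c v = p := by
    obtain ⟨v, hv, hvp⟩ := hp (diff j₁ j₂ c ^ (-n : ℤ))
    let f : ℤ × RemainingCoset A c → ℤ × RemainingCoset A c := fun z => (z.1 - n, z.2)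
    have hf : (liftConj A j₁ j₂ c).comp (FreeGroup.map f) =
        (MulAut.conj (diff j₁ j₂ c ^ (-n : ℤ))).toMonoidHom.comp (liftConj A j₁ j₂ c) := by
      ext1 z
      simp only [MonoidHom.comp_apply, liftConj, FreeGroup.map.of, FreeGroup.lift_apply_of, f,
        MulEquiv.coe_toMonoidHom, MulAut.conj_apply, zpow_sub, zpow_neg]
      group
    refine ⟨FreeGroup.map f v, ?_, ?_⟩
    · have h1 := Subgroup.mem_map_of_mem (FreeGroup.map f) hv
      rw [MonoidHom.map_closure] at h1
      refine Subgroup.closure_mono ?_ h1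
      rintro _ ⟨_, ⟨z, hz, rfl⟩, rfl⟩
      have hz' : z.1 ≤ 0 := hz
      exact ⟨f z, by simpa [f] using hz', by simp⟩
    · have h1 := DFunLike.congr_fun hf v
      simp only [MonoidHom.comp_apply, MulEquiv.coe_toMonoidHom, MulAut.conj_apply, hvp] at h1
      rw [h1]
      group
  choose v hv hvp using key
  have hv0 (n) : v n = v 0 := hP.liftConj_injective hc ((hvp n).trans (hvp 0).symm)
  have h1 : v 0 = 1 := FreeGroup.eq_one_of_forall_mem_closure (fun z => z.1) _
    fun n => hv0 n ▸ hv n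
  rw [← hvp 0, h1, map_one]

end IsAmalgamatedProduct

namespace IsAmalgamatedProduct

variable {G : Type} [Group G] {A : Subgroup G} {P : Type} [Group P] {j₁ j₂ : G →* P}

open Classical in
lemma mk_diff_mul_zpow (hP : IsAmalgamatedProduct A.subtype A.subtype j₁ j₂) (c u : G) {k : ℤ}
    (hk : 0 ≤ k) (p : P) :
    ((p * diff j₁ j₂ u * diff j₁ j₂ c ^ k : P) : P ⧸ stabilizer A j₁ j₂ c) =
      (p * diff j₁ j₂ c ^ (k + if (u : G ⧸ A) = c then 1 else 0) : P) := by
  split_ifs with h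
  · rw [hP.diff_eq h, add_comm, zpow_one_add, mul_assoc]
  · rw [eq_comm, add_zero, QuotientGroup.eq]
    convert hP.conj_diff_mem_stabilizer h hk using 1
    group

open Classical in
lemma mk_diff_inv_mul_zpow (hP : IsAmalgamatedProduct A.subtype A.subtype j₁ j₂) (c u : G) {k : ℤ}
    (hk : 0 ≤ k) (p : P) :
    ((p * (diff j₁ j₂ u)⁻¹ * diff j₁ j₂ c ^ k : P) : P ⧸ stabilizer A j₁ j₂ c) =
      (p * diff j₁ j₂ c ^ (k + if (u : G ⧸ A) = c then -1 else 0) : P) := by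
  split_ifs with h
  · rw [hP.diff_eq h, add_comm, zpow_add, zpow_neg_one, mul_assoc]
  · rw [QuotientGroup.eq, add_zero]
    convert hP.conj_diff_mem_stabilizer h hk using 1
    group

open Classical in
lemma amenableAction_quotient_stabilizer (hP : IsAmalgamatedProduct A.subtype A.subtype j₁ j₂)
    (hG : AmenableGroup G) (c : G) :
    AmenableAction (MulAction.toPermHom P (P ⧸ stabilizer A j₁ j₂ c)) := by
  obtain ⟨m, hm⟩ := hG
  obtain ⟨M, hM, hMshift, hMG, hMpos⟩ := exists_isMean_int_prod hm
  set t := diff j₁ j₂ c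
  set f : ℤ × G → P ⧸ stabilizer A j₁ j₂ c := fun x => (j₁ x.2 * t ^ x.1 : P)
  refine (hM.map f).amenableAction hP.closure_range_union ?_
  rintro _ (⟨h, rfl⟩ | ⟨h, rfl⟩) S
  · rw [← hMG h (f ⁻¹' S)]
    congr 1
    ext x
    simp [f, mul_assoc]
  · have hMpos' : M {x | 1 ≤ x.1} = 1 := by
      rw [← IsMean.int_prod_shift hMshift (-1)] at hMpos
      convert hMpos using 2
      ext x
      simp
    have hshift := (hM.int_prod_shift_on hMshift (-1) {g | ((g⁻¹ * h : G) : G ⧸ A) = c} _).trans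
      (hM.int_prod_shift_on hMshift 1 {g | ((g⁻¹ : G) : G ⧸ A) = c} (f ⁻¹' S))
    rw [← hMG h⁻¹, ← hshift]
    refine hM.congr_of_eq_one hMpos' fun x hx => ?_
    obtain ⟨k, g⟩ := x
    have hk : 1 ≤ k := hx
    have h1 : j₂ h * (j₁ (h⁻¹ * g) * t ^ k) =
        j₁ g * diff j₁ j₂ g⁻¹ * (diff j₁ j₂ (g⁻¹ * h))⁻¹ * t ^ k := by
      simp [diff, mul_assoc]
    have h2 : 0 ≤ k + if ((g⁻¹ * h : G) : G ⧸ A) = c then -1 else 0 := by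
      split_ifs <;> omega
    have h3 := (hP.mk_diff_inv_mul_zpow c (g⁻¹ * h) (by omega : 0 ≤ k)
      (j₁ g * diff j₁ j₂ g⁻¹)).trans (hP.mk_diff_mul_zpow c g⁻¹ h2 (j₁ g))
    rw [← h1] at h3
    simp only [Set.mem_preimage, f, MulAction.toPermHom_apply, MulAction.toPerm_apply,
      MulAction.Quotient.smul_coe, smul_eq_mul, Set.mem_ofPred_eq]
    rw [h3]
    congr!

lemma inClassA_of_notMem (hP : IsAmalgamatedProduct A.subtype A.subtype j₁ j₂) [Countable G]
    (hG : AmenableGroup G) {c : G} (hc : c ∉ A) : InClassA P := by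
  have := hP.countable
  refine ⟨P ⧸ stabilizer A j₁ j₂ c, QuotientGroup.mk_surjective.countable, MulAction.toPermHom P _, ?_,
    MulAction.exists_smul_eq P, hP.amenableAction_quotient_stabilizer hG c⟩
  rw [injective_iff_map_eq_one]
  refine fun p hp => hP.stabilizer_core hc fun q => ?_
  have h : ((p * q : P) : P ⧸ stabilizer A j₁ j₂ c) = q :=
    DFunLike.congr_fun hp (q : P ⧸ stabilizer A j₁ j₂ c)
  rw [mul_assoc]
  exact QuotientGroup.eq.1 h.symm

lemma inClassA_of_eq_top (hP : IsAmalgamatedProduct A.subtype A.subtype j₁ j₂) [Countable G]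
    (hG : AmenableGroup G) (hA : A = ⊤) : InClassA P := by
  have := hP.countable
  obtain ⟨m, hm⟩ := hG
  have hj : j₂ = j₁ := MonoidHom.ext fun g => (hP.apply_eq (hA ▸ Subgroup.mem_top g)).symm
  subst hj
  refine ⟨P, inferInstance, MulAction.toPermHom P P, MulAction.toPerm_injective,
    MulAction.exists_smul_eq P, (hm.isMean.map j₂).amenableAction hP.closure_range_union ?_⟩
  rintro _ (⟨h, rfl⟩ | ⟨h, rfl⟩) S
  all_goals
    rw [← hm.preimage h (j₂ ⁻¹' S)]
    congr 1
    ext x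
    simp

end IsAmalgamatedProduct

/-- Theorem 1, second part (Moon, arXiv:1003.3998).
Let `G` be a countable amenable group and `A ≤ G` any subgroup. Then the double of `G`
over `A`, i.e. the amalgamated free product `G ∗_A G` of two copies of `G` amalgamated
along the two copies of `A` via the identity isomorphism, is in the class `𝒜`. -/
theorem double_of_amenable_mem_classA
    (G : Type) [Group G] [Countable G] (hG : AmenableGroup G)
    (A : Subgroup G)
    (P : Type) [Group P] (j₁ j₂ : G →* P)
    (hP : IsAmalgamatedProduct A.subtype A.subtype j₁ j₂) :
    InClassA P := by
  by_cases hA : A = ⊤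
  · exact hP.inClassA_of_eq_top hG hA
  · obtain ⟨c, hc⟩ := not_forall.1 (mt (Subgroup.eq_top_iff' A).2 hA)
    exact hP.inClassA_of_notMem hG hc
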